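/- Let A be a Hermitian n×n matrix over the split quaternion algebra H, let b ∈ H, and for an index i let A_{.i}(a_{.i}·b) denote the matrix obtained from A by right-multiplying every entry of its i-th column by b. Then for every i = 1,…,n, rdet_i A_{.i}(a_{.i}·b) = (det A) · b. -/

import Mathlib

/-- The split quaternion (coquaternion) algebra over ℝ:
`i² = −1`, `j² = 1`, `k² = 1`, `ij = −ji = k`. -/
abbrev SplitQuaternion : Type := QuaternionAlgebra ℝ (-1) 0 1

noncomputable section

namespace SplitQuaternion

variable {n : ℕ}

/-- The ordered product of entries of `A` along the cycle of `σ` containing `s`,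
read in the "row" direction:
`a_{s, σ s} * a_{σ s, σ² s} * ⋯ * a_{σ^{L−1} s, s}` where `L` is the cycle length. -/
def rowCycleProd (A : Matrix (Fin n) (Fin n) SplitQuaternion) (σ : Equiv.Perm (Fin n))
    (s : Fin n) : SplitQuaternion :=
  ((List.range (Function.minimalPeriod σ s)).map
    (fun m => A ((σ ^ m) s) ((σ ^ (m + 1)) s))).prod

/-- The ordered product of entries of `A` along the cycle of `σ` containing `s`,
read in the "column" direction:
`a_{s, σ^{L−1} s} * ⋯ * a_{σ² s, σ s} * a_{σ s, s}` where `L` is the cycle length. -/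
def colCycleProd (A : Matrix (Fin n) (Fin n) SplitQuaternion) (σ : Equiv.Perm (Fin n))
    (s : Fin n) : SplitQuaternion :=
  (((List.range (Function.minimalPeriod σ s)).map
    (fun m => A ((σ ^ (m + 1)) s) ((σ ^ m) s))).reverse).prod

open scoped Classical in
/-- The least elements of the cycles of `σ` other than the cycle containing `i`,
listed in increasing order. -/
def otherCycleMins (σ : Equiv.Perm (Fin n)) (i : Fin n) : List (Fin n) :=
  (Finset.univ.filter (fun s : Fin n =>
    (∀ t, σ.SameCycle s t → s ≤ t) ∧ ¬ σ.SameCycle i s)).sort (· ≤ ·)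

/-- The `i`-th row determinant of `A`: the sum over all permutations `σ` of
`(−1)^{n−r}` (which is `sign σ`, `r` being the number of disjoint cycles of `σ`,
fixed points included) times the product of the entries of `A` ordered according to
the left-ordered cycle notation of `σ` whose first cycle starts with `i`, every
other cycle starting with its least element, the cycles being ordered by
increasing least elements. -/
def rdet (A : Matrix (Fin n) (Fin n) SplitQuaternion) (i : Fin n) : SplitQuaternion :=
  ∑ σ : Equiv.Perm (Fin n),
    ((Equiv.Perm.sign σ : ℤ) : SplitQuaternion) *
      (rowCycleProd A σ i * ((otherCycleMins σ i).map (rowCycleProd A σ)).prod)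

/-- The `j`-th column determinant of `A`: the sum over all permutations `τ` of
`(−1)^{n−r}` times the product of the entries of `A` ordered according to the
right-ordered cycle notation of `τ` whose rightmost cycle ends with `j`, every
other cycle ending with its least element, the cycles being ordered (from right
to left) by increasing least elements. -/
def cdet (A : Matrix (Fin n) (Fin n) SplitQuaternion) (j : Fin n) : SplitQuaternion :=
  ∑ σ : Equiv.Perm (Fin n),
    ((Equiv.Perm.sign σ : ℤ) : SplitQuaternion) *
      ((((otherCycleMins σ j).reverse).map (colCycleProd A σ)).prod * colCycleProd A σ j)

/-- The determinant of a Hermitian matrix: the common value of all row and column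
determinants (here given as `rdet` at the index `0`). -/
def hdet [NeZero n] (A : Matrix (Fin n) (Fin n) SplitQuaternion) : SplitQuaternion :=
  rdet A 0

open Equiv.Perm

section CycleReversal

variable {α : Type*} [DecidableEq α] [Fintype α]

/-- The permutation obtained from `σ` by reversing the cycle through `s`. -/
def reverseCycle (σ : Equiv.Perm α) (s : α) : Equiv.Perm α :=
  σ * ((σ.cycleOf s)⁻¹ * (σ.cycleOf s)⁻¹)

lemma sign_reverseCycle (σ : Equiv.Perm α) (s : α) :
    Equiv.Perm.sign (reverseCycle σ s) = Equiv.Perm.sign σ := by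
  rw [reverseCycle, map_mul, map_mul, Int.units_mul_self, mul_one]

lemma reverseCycle_apply_of_sameCycle {σ : Equiv.Perm α} {s t : α} (h : σ.SameCycle s t) :
    reverseCycle σ s t = σ⁻¹ t := by
  have h' : σ⁻¹.SameCycle s t := h.inv
  have h'' : σ⁻¹.SameCycle s (σ⁻¹ t) := sameCycle_apply_right.2 h'
  rw [reverseCycle, mul_apply, mul_apply, cycleOf_inv, h'.cycleOf_apply, h''.cycleOf_apply,
    ← mul_apply, mul_inv_cancel, one_apply]

lemma reverseCycle_apply_of_not_sameCycle {σ : Equiv.Perm α} {s t : α}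
    (h : ¬ σ.SameCycle s t) : reverseCycle σ s t = σ t := by
  have h' : ¬ σ⁻¹.SameCycle s t := fun h' => h (sameCycle_inv.1 h')
  simp [reverseCycle, cycleOf_inv, cycleOf_apply_of_not_sameCycle h']

lemma reverseCycle_pow_apply_of_sameCycle {σ : Equiv.Perm α} {s t : α} (h : σ.SameCycle s t)
    (m : ℕ) : (reverseCycle σ s ^ m) t = (σ⁻¹ ^ m) t := by
  induction m with
  | zero => rfl
  | succ m ih =>
    rw [pow_succ', pow_succ', mul_apply, mul_apply, ih]
    exact reverseCycle_apply_of_sameCycle (sameCycle_inv.1 (h.inv.trans ⟨m, by simp⟩))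

lemma reverseCycle_pow_apply_of_not_sameCycle {σ : Equiv.Perm α} {s t : α}
    (h : ¬ σ.SameCycle s t) (m : ℕ) : (reverseCycle σ s ^ m) t = (σ ^ m) t := by
  induction m with
  | zero => rfl
  | succ m ih =>
    rw [pow_succ', pow_succ', mul_apply, mul_apply, ih]
    exact reverseCycle_apply_of_not_sameCycle (by rwa [sameCycle_pow_right])

lemma sameCycle_reverseCycle (σ : Equiv.Perm α) (s x y : α) :
    (reverseCycle σ s).SameCycle x y ↔ σ.SameCycle x y := by
  by_cases hx : σ.SameCycle s x
  · constructor <;> intro h <;> [skip; replace h := sameCycle_inv.2 h] <;>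
      obtain ⟨m, rfl⟩ := h.exists_nat_pow_eq
    · rw [reverseCycle_pow_apply_of_sameCycle hx, ← sameCycle_inv, sameCycle_pow_right]
    · rw [← reverseCycle_pow_apply_of_sameCycle hx, sameCycle_pow_right]
  · constructor <;> intro h <;> obtain ⟨m, rfl⟩ := h.exists_nat_pow_eq
    · rw [reverseCycle_pow_apply_of_not_sameCycle hx, sameCycle_pow_right]
    · rw [← reverseCycle_pow_apply_of_not_sameCycle hx, sameCycle_pow_right]

lemma reverseCycle_reverseCycle (σ : Equiv.Perm α) (s : α) :
    reverseCycle (reverseCycle σ s) s = σ := by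
  ext t
  by_cases h : σ.SameCycle s t
  · rw [reverseCycle_apply_of_sameCycle ((sameCycle_reverseCycle σ s s t).2 h), inv_eq_iff_eq,
      reverseCycle_apply_of_sameCycle (sameCycle_apply_right.2 h), ← mul_apply, inv_mul_cancel,
      one_apply]
  · rw [reverseCycle_apply_of_not_sameCycle (mt (sameCycle_reverseCycle σ s s t).1 h),
      reverseCycle_apply_of_not_sameCycle h]

end CycleReversal

section ListProducts

lemma star_prod_map_range {R : Type*} [Monoid R] [StarMul R] (f : ℕ → R) (L : ℕ) :
    star ((List.range L).map f).prod =
      ((List.range L).map (fun m => star (f (L - 1 - m)))).prod := by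
  induction L with
  | zero => simp
  | succ L ih =>
    rw [List.prod_range_succ, star_mul, ih, List.prod_range_succ']
    congr 3
    funext m
    rw [show L - 1 - m = L + 1 - 1 - (m + 1) by omega]

lemma prod_map_add_prod_map {ι R : Type*} [Semiring R] {l : List ι} (hl : l.Nodup) {s : ι}
    (hs : s ∈ l) {f g h : ι → R} (hfg : ∀ t ∈ l, t ≠ s → f t = h t)
    (hgh : ∀ t ∈ l, t ≠ s → g t = h t) (hsum : f s + g s = 2 * h s) :
    (l.map f).prod + (l.map g).prod = 2 * (l.map h).prod := by
  induction l with
  | nil => simp at hs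
  | cons a l ih =>
    obtain ⟨ha, hl⟩ := List.nodup_cons.1 hl
    simp only [List.map_cons, List.prod_cons]
    by_cases has : a = s
    · subst has
      have e : ∀ k : ι → R, (∀ t ∈ a :: l, t ≠ a → k t = h t) → l.map k = l.map h := fun k hk =>
        List.map_congr_left fun t ht =>
          hk t (List.mem_cons_of_mem _ ht) (ne_of_mem_of_not_mem ht ha)
      rw [e f hfg, e g hgh, ← add_mul, hsum, mul_assoc]
    · rw [hfg a (by simp) has, hgh a (by simp) has, ← mul_add,
        ih hl ((List.mem_cons.1 hs).resolve_left (Ne.symm has))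
          (fun t ht => hfg t (List.mem_cons_of_mem _ ht))
          (fun t ht => hgh t (List.mem_cons_of_mem _ ht)),
        ← mul_assoc, ← mul_assoc, mul_two, two_mul]

end ListProducts

section RowCycles

lemma rowCycleProd_congr (A : Matrix (Fin n) (Fin n) SplitQuaternion) {σ τ : Equiv.Perm (Fin n)}
    {s : Fin n} (h : ∀ m : ℕ, (σ ^ m) s = (τ ^ m) s) :
    rowCycleProd A σ s = rowCycleProd A τ s := by
  have hp : Function.minimalPeriod σ s = Function.minimalPeriod τ s :=
    Function.minimalPeriod_eq_minimalPeriod_iff.2 fun m => by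
      simp only [Function.IsPeriodicPt, Function.IsFixedPt, iterate_eq_pow, h]
  simp only [rowCycleProd, hp, h]

lemma pow_minimalPeriod_apply (σ : Equiv.Perm (Fin n)) (s : Fin n) :
    (σ ^ Function.minimalPeriod σ s) s = s := by
  rw [← iterate_eq_pow, Function.iterate_minimalPeriod]

lemma mem_periodicPts (σ : Equiv.Perm (Fin n)) (s : Fin n) : s ∈ Function.periodicPts σ :=
  ⟨orderOf σ, orderOf_pos σ, by
    rw [Function.IsPeriodicPt, Function.IsFixedPt, iterate_eq_pow, pow_orderOf_eq_one, one_apply]⟩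

lemma exists_minimalPeriod_eq_succ (σ : Equiv.Perm (Fin n)) (s : Fin n) :
    ∃ k, Function.minimalPeriod σ s = k + 1 :=
  Nat.exists_eq_add_one.2 (Function.minimalPeriod_pos_of_mem_periodicPts (mem_periodicPts σ s))

lemma rowCycleProd_inv {A : Matrix (Fin n) (Fin n) SplitQuaternion} (hA : A.IsHermitian)
    (σ : Equiv.Perm (Fin n)) (s : Fin n) :
    rowCycleProd A σ⁻¹ s = star (rowCycleProd A σ s) := by
  have hp : Function.minimalPeriod (σ⁻¹ : Equiv.Perm (Fin n)) s = Function.minimalPeriod σ s :=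
    Function.minimalPeriod_eq_minimalPeriod_iff.2 fun m => by
      simp only [Function.IsPeriodicPt, Function.IsFixedPt, iterate_eq_pow, inv_pow,
        inv_eq_iff_eq]
      exact eq_comm
  rw [rowCycleProd, rowCycleProd, star_prod_map_range, hp]
  refine congrArg List.prod (List.map_congr_left fun m hm => ?_)
  have hm : m < Function.minimalPeriod σ s := List.mem_range.1 hm
  have key : ∀ j ≤ Function.minimalPeriod σ s,
      (σ⁻¹ ^ j) s = (σ ^ (Function.minimalPeriod σ s - j)) s := fun j hj => by
    rw [inv_pow, inv_eq_iff_eq, ← mul_apply, ← pow_add, Nat.add_sub_cancel' hj,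
      pow_minimalPeriod_apply]
  rw [key m hm.le, key (m + 1) hm, hA.apply,
    show Function.minimalPeriod σ s - m = Function.minimalPeriod σ s - 1 - m + 1 by omega,
    show Function.minimalPeriod σ s - (m + 1) = Function.minimalPeriod σ s - 1 - m by omega]

lemma re_mul_comm (x y : SplitQuaternion) : (x * y).re = (y * x).re := by
  simp only [QuaternionAlgebra.re_mul]
  ring

lemma re_rowCycleProd_apply (A : Matrix (Fin n) (Fin n) SplitQuaternion)
    (σ : Equiv.Perm (Fin n)) (s : Fin n) :
    (rowCycleProd A σ (σ s)).re = (rowCycleProd A σ s).re := by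
  obtain ⟨k, hk⟩ := exists_minimalPeriod_eq_succ σ s
  have hs : (σ ^ (k + 1)) s = s := hk ▸ pow_minimalPeriod_apply σ s
  have e : ∀ m : ℕ, (σ ^ m) (σ s) = (σ ^ (m + 1)) s := fun m => by rw [pow_succ, mul_apply]
  rw [rowCycleProd, rowCycleProd, Function.minimalPeriod_apply (mem_periodicPts σ s), hk,
    List.prod_range_succ, List.prod_range_succ', re_mul_comm]
  have hs' : (σ ^ (k + 1 + 1)) s = σ s := by rw [pow_succ', mul_apply, hs]
  simp only [e, hs, hs', pow_zero, one_apply, zero_add, pow_one]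

lemma re_rowCycleProd_eq_of_sameCycle (A : Matrix (Fin n) (Fin n) SplitQuaternion)
    {σ : Equiv.Perm (Fin n)} {s t : Fin n} (h : σ.SameCycle s t) :
    (rowCycleProd A σ t).re = (rowCycleProd A σ s).re := by
  obtain ⟨m, rfl⟩ := h.exists_nat_pow_eq
  induction m with
  | zero => rfl
  | succ m ih =>
    rw [pow_succ', mul_apply, re_rowCycleProd_apply, ih ⟨m, by simp⟩]

lemma rowCycleProd_updateCol_self (A : Matrix (Fin n) (Fin n) SplitQuaternion)
    (σ : Equiv.Perm (Fin n)) (i : Fin n) (b : SplitQuaternion) :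
    rowCycleProd (A.updateCol i (fun p => A p i * b)) σ i = rowCycleProd A σ i * b := by
  obtain ⟨k, hk⟩ := exists_minimalPeriod_eq_succ σ i
  have hi : (σ ^ (k + 1)) i = i := hk ▸ pow_minimalPeriod_apply σ i
  rw [rowCycleProd, rowCycleProd, hk, List.prod_range_succ, List.prod_range_succ, hi,
    Matrix.updateCol_self, mul_assoc]
  congr 2
  refine List.map_congr_left fun m hm => Matrix.updateCol_ne fun h => ?_
  rw [← iterate_eq_pow] at h
  exact Function.not_isPeriodicPt_of_pos_of_lt_minimalPeriod (Nat.succ_ne_zero m)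
    (by have := List.mem_range.1 hm; omega) h

lemma rowCycleProd_updateCol_of_not_sameCycle (A : Matrix (Fin n) (Fin n) SplitQuaternion)
    {σ : Equiv.Perm (Fin n)} {i s : Fin n} (h : ¬ σ.SameCycle i s) (v : Fin n → SplitQuaternion) :
    rowCycleProd (A.updateCol i v) σ s = rowCycleProd A σ s := by
  refine congrArg List.prod (List.map_congr_left fun m _ => Matrix.updateCol_ne fun hm => h ?_)
  exact SameCycle.symm ⟨(m + 1 : ℕ), by rw [zpow_natCast]; exact hm⟩

end RowCycles

section Leaders

/-- The starting points of the cycles in the left-ordered cycle notation of `σ` whose first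
cycle starts with `i`. -/
def cycleLeaders (σ : Equiv.Perm (Fin n)) (i : Fin n) : List (Fin n) :=
  i :: otherCycleMins σ i

lemma mem_otherCycleMins {σ : Equiv.Perm (Fin n)} {i s : Fin n} :
    s ∈ otherCycleMins σ i ↔ (∀ t, σ.SameCycle s t → s ≤ t) ∧ ¬ σ.SameCycle i s := by
  simp [otherCycleMins]

lemma not_mem_otherCycleMins_self (σ : Equiv.Perm (Fin n)) (i : Fin n) :
    i ∉ otherCycleMins σ i :=
  fun h => (mem_otherCycleMins.1 h).2 (SameCycle.refl σ i)

lemma nodup_cycleLeaders (σ : Equiv.Perm (Fin n)) (i : Fin n) : (cycleLeaders σ i).Nodup :=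
  List.nodup_cons.2 ⟨not_mem_otherCycleMins_self σ i, Finset.sort_nodup _ _⟩

lemma cycleLeaders_reverseCycle (σ : Equiv.Perm (Fin n)) (s i : Fin n) :
    cycleLeaders (reverseCycle σ s) i = cycleLeaders σ i := by
  simp only [cycleLeaders, otherCycleMins, sameCycle_reverseCycle]

lemma not_sameCycle_of_mem_cycleLeaders {σ : Equiv.Perm (Fin n)} {i s t : Fin n}
    (hs : s ∈ cycleLeaders σ i) (ht : t ∈ cycleLeaders σ i) (hts : t ≠ s) :
    ¬ σ.SameCycle s t := by
  intro h
  rcases List.mem_cons.1 hs with rfl | hs <;> rcases List.mem_cons.1 ht with rfl | ht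
  · exact hts rfl
  · exact (mem_otherCycleMins.1 ht).2 h
  · exact (mem_otherCycleMins.1 hs).2 h.symm
  · exact hts (le_antisymm ((mem_otherCycleMins.1 ht).1 s h.symm) ((mem_otherCycleMins.1 hs).1 t h))

open scoped Classical in
/-- A product over the cycles of `σ` of a quantity constant on cycles does not depend on which
starting points are chosen. -/
lemma prod_map_cycleLeaders {M : Type*} [CommMonoid M] (σ : Equiv.Perm (Fin n)) (i : Fin n)
    {r : Fin n → M} (hr : ∀ s t, σ.SameCycle s t → r t = r s) :
    ((cycleLeaders σ i).map r).prod =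
      ∏ s with ∀ t, σ.SameCycle s t → s ≤ t, r s := by
  obtain ⟨m, hm, hmin⟩ := Finset.exists_min_image
    (Finset.univ.filter fun t => σ.SameCycle i t) id ⟨i, by simp [SameCycle.refl]⟩
  have him : σ.SameCycle i m := by simpa using hm
  have hmin : ∀ t, σ.SameCycle m t → m ≤ t := fun t ht => hmin t (by simpa using him.trans ht)
  have hfilter : Finset.univ.filter (fun s => ∀ t, σ.SameCycle s t → s ≤ t) =
      insert m (Finset.univ.filter
        (fun s => (∀ t, σ.SameCycle s t → s ≤ t) ∧ ¬ σ.SameCycle i s)) := by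
    ext s
    simp only [Finset.mem_filter, Finset.mem_univ, true_and, Finset.mem_insert]
    constructor
    · intro hs
      by_cases his : σ.SameCycle i s
      · have hms := him.symm.trans his
        exact Or.inl (le_antisymm (hs m hms.symm) (hmin s hms))
      · exact Or.inr ⟨hs, his⟩
    · rintro (rfl | hs)
      · exact hmin
      · exact hs.1
  rw [hfilter, Finset.prod_insert (by simp [him]), cycleLeaders, List.map_cons, List.prod_cons,
    hr i m him, otherCycleMins, ← List.prod_toFinset _ (Finset.sort_nodup _ _),
    Finset.sort_toFinset]

end Leaders

section Averaging

/-- The ordered product along the cycle of `σ` through `s`, replaced by its real part when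
`s ∈ T`, and right-multiplied by `b` when `s = i`. -/
def partialRealCycleProd (A : Matrix (Fin n) (Fin n) SplitQuaternion) (b : SplitQuaternion)
    (i : Fin n) (T : Finset (Fin n)) (σ : Equiv.Perm (Fin n)) (s : Fin n) : SplitQuaternion :=
  (if s ∈ T then ((rowCycleProd A σ s).re : SplitQuaternion) else rowCycleProd A σ s) *
    (if s = i then b else 1)

/-- The signed sum over all permutations of the products of the `partialRealCycleProd`s. -/
def partialRealRdet (A : Matrix (Fin n) (Fin n) SplitQuaternion) (b : SplitQuaternion)
    (i : Fin n) (T : Finset (Fin n)) : SplitQuaternion :=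
  ∑ σ : Equiv.Perm (Fin n), ((Equiv.Perm.sign σ : ℤ) : SplitQuaternion) *
    ((cycleLeaders σ i).map (partialRealCycleProd A b i T σ)).prod

lemma partialRealRdet_empty (A : Matrix (Fin n) (Fin n) SplitQuaternion) (b : SplitQuaternion)
    (i : Fin n) :
    partialRealRdet A b i ∅ = rdet (A.updateCol i (fun p => A p i * b)) i := by
  refine Finset.sum_congr rfl fun σ _ => ?_
  rw [cycleLeaders, List.map_cons, List.prod_cons, rowCycleProd_updateCol_self]
  congr 2
  · simp [partialRealCycleProd]
  · refine congrArg List.prod (List.map_congr_left fun s hs => ?_)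
    have hsi : s ≠ i := ne_of_mem_of_not_mem hs (not_mem_otherCycleMins_self σ i)
    rw [rowCycleProd_updateCol_of_not_sameCycle A (mem_otherCycleMins.1 hs).2]
    simp [partialRealCycleProd, hsi]

lemma rowCycleProd_reverseCycle_of_not_sameCycle (A : Matrix (Fin n) (Fin n) SplitQuaternion)
    {σ : Equiv.Perm (Fin n)} {s t : Fin n} (h : ¬ σ.SameCycle s t) :
    rowCycleProd A (reverseCycle σ s) t = rowCycleProd A σ t :=
  rowCycleProd_congr A (reverseCycle_pow_apply_of_not_sameCycle h)

lemma rowCycleProd_reverseCycle_self {A : Matrix (Fin n) (Fin n) SplitQuaternion}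
    (hA : A.IsHermitian) (σ : Equiv.Perm (Fin n)) (s : Fin n) :
    rowCycleProd A (reverseCycle σ s) s = star (rowCycleProd A σ s) := by
  rw [rowCycleProd_congr A (reverseCycle_pow_apply_of_sameCycle (SameCycle.refl σ s)),
    rowCycleProd_inv hA]

lemma add_star_eq_two_mul_re (x : SplitQuaternion) : x + star x = 2 * (x.re : SplitQuaternion) := by
  rw [QuaternionAlgebra.self_add_star]
  simp

lemma partialRealRdet_insert {A : Matrix (Fin n) (Fin n) SplitQuaternion} (hA : A.IsHermitian)
    (b : SplitQuaternion) (i : Fin n) {T : Finset (Fin n)} {s : Fin n} (hs : s ∉ T) :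
    partialRealRdet A b i (insert s T) = partialRealRdet A b i T := by
  classical
  let e : Equiv.Perm (Fin n) → Equiv.Perm (Fin n) := fun σ =>
    if s ∈ cycleLeaders σ i then reverseCycle σ s else σ
  have he : Function.Involutive e := fun σ => by
    by_cases h : s ∈ cycleLeaders σ i
    · simp [e, h, cycleLeaders_reverseCycle, reverseCycle_reverseCycle]
    · simp [e, h]
  have hinsert : ∀ (σ : Equiv.Perm (Fin n)) (t : Fin n), t ≠ s →
      partialRealCycleProd A b i T σ t = partialRealCycleProd A b i (insert s T) σ t :=
    fun σ t ht => by simp [partialRealCycleProd, ht]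
  have hpair : ∀ σ : Equiv.Perm (Fin n),
      ((Equiv.Perm.sign (e σ) : ℤ) : SplitQuaternion) *
          ((cycleLeaders (e σ) i).map (partialRealCycleProd A b i T (e σ))).prod +
        ((Equiv.Perm.sign σ : ℤ) : SplitQuaternion) *
          ((cycleLeaders σ i).map (partialRealCycleProd A b i T σ)).prod =
      2 * (((Equiv.Perm.sign σ : ℤ) : SplitQuaternion) *
        ((cycleLeaders σ i).map (partialRealCycleProd A b i (insert s T) σ)).prod) := by
    intro σ
    by_cases h : s ∈ cycleLeaders σ i
    · simp only [e, if_pos h, sign_reverseCycle, cycleLeaders_reverseCycle]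
      rw [← mul_add, prod_map_add_prod_map (h := partialRealCycleProd A b i (insert s T) σ)
        (nodup_cycleLeaders σ i) h, (Int.cast_commute _ 2).left_comm]
      · intro t ht hts
        rw [← hinsert σ t hts, partialRealCycleProd, partialRealCycleProd,
          rowCycleProd_reverseCycle_of_not_sameCycle A
            (not_sameCycle_of_mem_cycleLeaders h ht hts)]
      · exact fun t _ hts => hinsert σ t hts
      · simp only [partialRealCycleProd, if_neg hs, if_pos (Finset.mem_insert_self s T),
          rowCycleProd_reverseCycle_self hA]
        rw [← add_mul, add_comm (star _), add_star_eq_two_mul_re, mul_assoc]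
    · simp only [e, if_neg h]
      rw [← two_mul, List.map_congr_left fun t ht => hinsert σ t (ne_of_mem_of_not_mem ht h)]
  have hdouble : (2 : ℝ) • partialRealRdet A b i (insert s T) =
      (2 : ℝ) • partialRealRdet A b i T := by
    rw [two_smul, ← two_mul, two_smul]
    nth_rewrite 2 [partialRealRdet]
    rw [← Equiv.sum_comp he.toPerm, partialRealRdet, partialRealRdet, ← Finset.sum_add_distrib,
      Finset.mul_sum]
    exact Finset.sum_congr rfl fun σ _ => (hpair σ).symm
  exact smul_right_injective _ (two_ne_zero (α := ℝ)) hdouble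

lemma partialRealRdet_univ (A : Matrix (Fin n) (Fin n) SplitQuaternion) (b : SplitQuaternion)
    (i : Fin n) :
    partialRealRdet A b i Finset.univ =
      (∑ σ : Equiv.Perm (Fin n), ((Equiv.Perm.sign σ : ℤ) : SplitQuaternion) *
        ((((cycleLeaders σ i).map fun s => (rowCycleProd A σ s).re).prod : ℝ) :
          SplitQuaternion)) * b := by
  rw [partialRealRdet, Finset.sum_mul]
  refine Finset.sum_congr rfl fun σ _ => ?_
  have htail : (otherCycleMins σ i).map (partialRealCycleProd A b i Finset.univ σ) =
      (otherCycleMins σ i).map fun s => ((rowCycleProd A σ s).re : SplitQuaternion) :=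
    List.map_congr_left fun s hs => by
      simp [partialRealCycleProd, ne_of_mem_of_not_mem hs (not_mem_otherCycleMins_self σ i)]
  have hcoe : ∀ l : List (Fin n),
      ((l.map fun s => (rowCycleProd A σ s).re).prod : SplitQuaternion) =
      (l.map fun s => ((rowCycleProd A σ s).re : SplitQuaternion)).prod := fun l => by
    induction l with
    | nil => simp
    | cons a l ih => simp [ih]
  rw [mul_assoc, cycleLeaders, List.map_cons, List.prod_cons, htail, List.map_cons, List.prod_cons,
    QuaternionAlgebra.coe_mul, ← hcoe, mul_assoc (QuaternionAlgebra.coe _) _ b,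
    QuaternionAlgebra.comm _ b]
  simp [partialRealCycleProd, mul_assoc]

end Averaging

/-- Right-multiplying the `i`-th column of a Hermitian matrix by `b` multiplies by `b` the signed
sum over all permutations of the products of the real parts of the cycle products. -/
lemma rdet_updateCol_mul_right_eq_sum {A : Matrix (Fin n) (Fin n) SplitQuaternion}
    (hA : A.IsHermitian) (b : SplitQuaternion) (i : Fin n) :
    rdet (A.updateCol i (fun p => A p i * b)) i =
      (∑ σ : Equiv.Perm (Fin n), ((Equiv.Perm.sign σ : ℤ) : SplitQuaternion) *
        ((((cycleLeaders σ i).map fun s => (rowCycleProd A σ s).re).prod : ℝ) :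
          SplitQuaternion)) * b := by
  rw [← partialRealRdet_univ, ← partialRealRdet_empty]
  induction (Finset.univ : Finset (Fin n)) using Finset.induction_on with
  | empty => rfl
  | insert s T hs ih => rw [partialRealRdet_insert hA b i hs, ih]

/-- If the `i`-th column of a Hermitian matrix `A` is right-multiplied by `b`, then
the `i`-th row determinant of the resulting matrix equals `det A · b`. -/
theorem rdet_updateColumn_mul_right_of_isHermitian [NeZero n]
    (A : Matrix (Fin n) (Fin n) SplitQuaternion) (hA : A.IsHermitian)
    (b : SplitQuaternion) :
    ∀ i : Fin n, rdet (A.updateCol i (fun p => A p i * b)) i = hdet A * b := by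
  intro i
  have h0 : rdet A 0 = rdet (A.updateCol 0 (fun p => A p 0 * 1)) 0 := by
    simp only [mul_one, Matrix.updateCol_eq_self]
  rw [hdet, h0, rdet_updateCol_mul_right_eq_sum hA, rdet_updateCol_mul_right_eq_sum hA, mul_one]
  simp only [prod_map_cycleLeaders _ _ fun _ _ => re_rowCycleProd_eq_of_sameCycle A]

end SplitQuaternion

end
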